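/- arXiv:1208.2438 — 5 statements merged into one kernel-verified Lean document; each statement's English description precedes it below -/
import Mathlib

section
/- Fix an integer ℓ ≥ 1 and let r_ℓ be the recursively defined rank function. If t ≤ ℓ, t ≤ j, and j ≡ t (mod 2), then r_ℓ(j,t) > 0. -/
/-- The recursively defined rank function `r ℓ j t`, computing the rank of the
vector bundle of conformal blocks `V(sl₂, ℓ, (ω₁,…,ω₁ (j times), t·ω₁))`:
`r ℓ 0 0 = 1`, `r ℓ 0 t = 0` for `t > 0`, and for `j ≥ 1`,
`r ℓ j t = 0` if `t > ℓ`, while `r ℓ j t = r ℓ (j-1) (t-1) + r ℓ (j-1) (t+1)`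
for `0 ≤ t ≤ ℓ` (with the convention `r ℓ (j-1) (-1) = 0`). -/
def cbRank (ℓ : ℕ) : ℕ → ℕ → ℕ
  | 0, t => if t = 0 then 1 else 0
  | j + 1, t =>
      if ℓ < t then 0
      else (if t = 0 then 0 else cbRank ℓ j (t - 1)) + cbRank ℓ j (t + 1)

theorem cbRank_pos (ℓ : ℕ) (hℓ : 1 ≤ ℓ) (j t : ℕ) (htℓ : t ≤ ℓ) (htj : t ≤ j)
    (hpar : j % 2 = t % 2) : 0 < cbRank ℓ j t := by
  induction j generalizing t with
  | zero =>
    obtain rfl : t = 0 := by omega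
    simp [cbRank]
  | succ j ih =>
    rw [cbRank, if_neg (by omega)]
    by_cases ht : t = 0
    · have := ih (t + 1) (by omega) (by omega) (by omega)
      omega
    · have := ih (t - 1) (by omega) (by omega) (by omega)
      rw [if_neg ht]
      omega
end

section
/- Fix an integer ℓ ≥ 1 and let r_ℓ be the recursively defined rank function. Let i₁ < i₂ and j₁ < j₂ be natural numbers with i₁ ≡ i₂ ≡ j₁ ≡ j₂ (mod 2) (all four of the same parity). Then r_ℓ(i₁,j₁)·r_ℓ(i₂,j₂) − r_ℓ(i₁,j₂)·r_ℓ(i₂,j₁) ≥ 0. -/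
theorem cbRank_mul_le_mul (ℓ i k : ℕ) {s t : ℕ} (hst : s ≤ t) (hpar : s % 2 = t % 2) :
    cbRank ℓ i t * cbRank ℓ (i + k) s ≤ cbRank ℓ i s * cbRank ℓ (i + k) t := by
  induction i generalizing s t with
  | zero =>
    rcases Nat.eq_zero_or_pos t with rfl | ht
    · rw [Nat.le_zero.mp hst]
    · simp [cbRank, ht.ne']
  | succ i ih =>
    rcases hst.eq_or_lt with rfl | hlt
    · rfl
    by_cases htl : ℓ < t
    · simp [cbRank, htl]
    rw [Nat.add_right_comm i 1 k]
    have ht : t ≠ 0 := by omega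
    have hsl : ¬ ℓ < s := by omega
    have h₁ := ih (s := s + 1) (t := t - 1) (by omega) (by omega)
    have h₂ := ih (s := s + 1) (t := t + 1) (by omega) (by omega)
    rcases Nat.eq_zero_or_pos s with rfl | hs
    · simp only [cbRank, htl, hsl, ht, if_true, if_false]
      linarith
    · have h₃ := ih (s := s - 1) (t := t - 1) (by omega) (by omega)
      have h₄ := ih (s := s - 1) (t := t + 1) (by omega) (by omega)
      simp only [cbRank, htl, hsl, ht, hs.ne', if_false]
      linarith

theorem cbRank_positive_determinants (ℓ : ℕ) (hℓ : 1 ≤ ℓ)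
    (i₁ i₂ j₁ j₂ : ℕ) (hi : i₁ < i₂) (hj : j₁ < j₂)
    (h₁ : i₁ % 2 = i₂ % 2) (h₂ : i₂ % 2 = j₁ % 2) (h₃ : j₁ % 2 = j₂ % 2) :
    0 ≤ (cbRank ℓ i₁ j₁ : ℤ) * (cbRank ℓ i₂ j₂ : ℤ)
        - (cbRank ℓ i₁ j₂ : ℤ) * (cbRank ℓ i₂ j₁ : ℤ) := by
  obtain ⟨k, rfl⟩ := Nat.exists_eq_add_of_le hi.le
  exact sub_nonneg.mpr (mod_cast cbRank_mul_le_mul ℓ i₁ k hj.le h₃)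
end

section
/- Fix an integer ℓ ≥ 2 and let r_ℓ be the recursively defined rank function. Then for all natural numbers i and m: r_ℓ(i+2,ℓ)·r_ℓ(m,ℓ) − r_ℓ(i,ℓ)·r_ℓ(m+2,ℓ) = r_ℓ(i,ℓ−2)·r_ℓ(m,ℓ) − r_ℓ(i,ℓ)·r_ℓ(m,ℓ−2). -/
theorem cbRank_eq_zero_of_lt {ℓ t : ℕ} (h : ℓ < t) (j : ℕ) : cbRank ℓ j t = 0 := by
  cases j with
  | zero => simp [cbRank, Nat.ne_of_gt (Nat.zero_lt_of_lt h)]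
  | succ j => simp [cbRank, h]

theorem cbRank_add_two_top {ℓ : ℕ} (hℓ : 2 ≤ ℓ) (j : ℕ) :
    cbRank ℓ (j + 2) ℓ = cbRank ℓ j (ℓ - 2) + cbRank ℓ j ℓ := by
  obtain ⟨k, rfl⟩ := Nat.exists_eq_add_of_le' hℓ
  have h : cbRank (k + 2) (j + 1) (k + 3) = 0 := cbRank_eq_zero_of_lt (by omega) _
  rw [cbRank, h]
  simp [cbRank]

theorem cbRank_determinant_identity (ℓ : ℕ) (hℓ : 2 ≤ ℓ) (i m : ℕ) :
    (cbRank ℓ (i + 2) ℓ : ℤ) * (cbRank ℓ m ℓ : ℤ)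
        - (cbRank ℓ i ℓ : ℤ) * (cbRank ℓ (m + 2) ℓ : ℤ)
      = (cbRank ℓ i (ℓ - 2) : ℤ) * (cbRank ℓ m ℓ : ℤ)
        - (cbRank ℓ i ℓ : ℤ) * (cbRank ℓ m (ℓ - 2) : ℤ) := by
  rw [cbRank_add_two_top hℓ i, cbRank_add_two_top hℓ m]
  push_cast
  ring
end

section
/- Let k, ℓ, i, t be integers with 1 < k < ℓ, 1 ≤ i, and 0 ≤ t ≤ ℓ. Define the predicate N to hold if and only if: k·i + t is even, and for all integers s, e with 0 ≤ s ≤ i, e ∈ {0,1}, and (i + 1) − (s + e) odd, one has k·i + t − i·ℓ ≤ s·(2k − ℓ) + e·(2t − ℓ). Then N fails if and only if at least one of the following holds (all divisions taken in ℚ): (0) k·i + t is odd; (1) 2k ≤ ℓ and i < max{t/k, 2 − t/k}; (2) 2k > ℓ, i is even, and i < max{t/(ℓ−k), 2 − t/(ℓ−k)}; (3) 2k > ℓ, i is odd, and i < max{(ℓ−t)/(ℓ−k), 2 − (ℓ−t)/(ℓ−k)}. -/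
theorem intCast_lt_max_div_iff {i a b : ℤ} (hb : 0 < b) :
    (i : ℚ) < max ((a : ℚ) / (b : ℚ)) (2 - (a : ℚ) / (b : ℚ)) ↔ i * b < a ∨ i * b + a < 2 * b := by
  have hb' : (0 : ℚ) < b := by exact_mod_cast hb
  rw [lt_max_iff, lt_div_iff₀ hb', lt_sub_comm, div_lt_iff₀ hb', sub_mul, lt_sub_iff_add_lt,
    add_comm (a : ℚ)]
  norm_cast

/-- When `2 * k ≤ ℓ`, the binding inequalities are those at `(s, e) = (i, 0)` and `(i - 1, 1)`. -/
theorem forall_le_iff_of_two_mul_le {k ℓ i t : ℤ} (hi : 1 ≤ i) (h : 2 * k ≤ ℓ) :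
    (∀ s e : ℤ, 0 ≤ s → s ≤ i → (e = 0 ∨ e = 1) → Odd ((i + 1) - (s + e)) →
      k * i + t - i * ℓ ≤ s * (2 * k - ℓ) + e * (2 * t - ℓ)) ↔
      t ≤ i * k ∧ 2 * k ≤ i * k + t := by
  constructor
  · intro H
    have h₀ := H i 0 (by lia) le_rfl (by simp) ⟨0, by ring⟩
    have h₁ := H (i - 1) 1 (by lia) (by lia) (by simp) ⟨0, by ring⟩
    constructor <;> linarith
  · rintro ⟨h₀, h₁⟩ s e - hs (rfl | rfl) ⟨m, hm⟩
    · nlinarith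
    · have : s ≤ i - 1 := by lia
      nlinarith

/-- When `ℓ < 2 * k` and `i` is even, the binding inequalities are those at `(s, e) = (0, 0)` and
`(1, 1)`. -/
theorem forall_le_iff_of_lt_two_mul_of_even {k ℓ i t : ℤ} (hi : 1 ≤ i) (h : ℓ < 2 * k)
    (hE : Even i) :
    (∀ s e : ℤ, 0 ≤ s → s ≤ i → (e = 0 ∨ e = 1) → Odd ((i + 1) - (s + e)) →
      k * i + t - i * ℓ ≤ s * (2 * k - ℓ) + e * (2 * t - ℓ)) ↔
      t ≤ i * (ℓ - k) ∧ 2 * (ℓ - k) ≤ i * (ℓ - k) + t := by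
  obtain ⟨j, hj⟩ := hE
  constructor
  · intro H
    have h₀ := H 0 0 le_rfl (by lia) (by simp) ⟨j, by lia⟩
    have h₁ := H 1 1 (by lia) hi (by simp) ⟨j - 1, by lia⟩
    constructor <;> linarith
  · rintro ⟨h₀, h₁⟩ s e hs - (rfl | rfl) ⟨m, hm⟩
    · nlinarith
    · have : 1 ≤ s := by lia
      nlinarith

/-- When `ℓ < 2 * k` and `i` is odd, the binding inequalities are those at `(s, e) = (0, 1)` and
`(1, 0)`. -/
theorem forall_le_iff_of_lt_two_mul_of_odd {k ℓ i t : ℤ} (hi : 1 ≤ i) (h : ℓ < 2 * k)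
    (hO : Odd i) :
    (∀ s e : ℤ, 0 ≤ s → s ≤ i → (e = 0 ∨ e = 1) → Odd ((i + 1) - (s + e)) →
      k * i + t - i * ℓ ≤ s * (2 * k - ℓ) + e * (2 * t - ℓ)) ↔
      ℓ - t ≤ i * (ℓ - k) ∧ 2 * (ℓ - k) ≤ i * (ℓ - k) + (ℓ - t) := by
  obtain ⟨j, hj⟩ := hO
  constructor
  · intro H
    have h₀ := H 0 1 le_rfl (by lia) (by simp) ⟨j, by lia⟩
    have h₁ := H 1 0 (by lia) hi (by simp) ⟨j, by lia⟩
    constructor <;> linarith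
  · rintro ⟨h₀, h₁⟩ s e hs - (rfl | rfl) ⟨m, hm⟩
    · have : 1 ≤ s := by lia
      nlinarith
    · nlinarith


theorem rank_vanishing_criterion (k ℓ i t : ℤ)
    (hk1 : 1 < k) (hkℓ : k < ℓ) (hi : 1 ≤ i) (ht0 : 0 ≤ t) (htℓ : t ≤ ℓ) :
    ¬ (Even (k * i + t) ∧
        ∀ s e : ℤ, 0 ≤ s → s ≤ i → (e = 0 ∨ e = 1) →
          Odd ((i + 1) - (s + e)) →
          k * i + t - i * ℓ ≤ s * (2 * k - ℓ) + e * (2 * t - ℓ)) ↔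
      (Odd (k * i + t) ∨
       (2 * k ≤ ℓ ∧ (i : ℚ) < max ((t : ℚ) / (k : ℚ)) (2 - (t : ℚ) / (k : ℚ))) ∨
       (ℓ < 2 * k ∧ Even i ∧
         (i : ℚ) < max ((t : ℚ) / ((ℓ : ℚ) - (k : ℚ)))
           (2 - (t : ℚ) / ((ℓ : ℚ) - (k : ℚ)))) ∨
       (ℓ < 2 * k ∧ Odd i ∧
         (i : ℚ) < max (((ℓ : ℚ) - (t : ℚ)) / ((ℓ : ℚ) - (k : ℚ)))
           (2 - ((ℓ : ℚ) - (t : ℚ)) / ((ℓ : ℚ) - (k : ℚ))))) := by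
  have hb : 0 < ℓ - k := sub_pos.2 hkℓ
  simp only [← Int.cast_sub]
  rw [intCast_lt_max_div_iff (zero_lt_one.trans hk1), intCast_lt_max_div_iff hb,
    intCast_lt_max_div_iff hb, not_and_or, Int.not_even_iff_odd]
  refine or_congr_right ?_
  rcases le_or_gt (2 * k) ℓ with h | h
  · rw [forall_le_iff_of_two_mul_le hi h, not_and_or, not_le, not_le]
    simp [h, h.not_gt]
  · rcases Int.even_or_odd i with hE | hO
    · rw [forall_le_iff_of_lt_two_mul_of_even hi h hE, not_and_or, not_le, not_le]
      simp only [h, h.not_ge, hE, Int.not_odd_iff_even.2 hE, true_and, false_and, and_false,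
        false_or, or_false]
    · rw [forall_le_iff_of_lt_two_mul_of_odd hi h hO, not_and_or, not_le, not_le]
      simp only [h, h.not_ge, hO, Int.not_even_iff_odd.2 hO, true_and, false_and, and_false,
        false_or]
end

section
/- Let g ≥ 2 and ℓ be integers with 1 ≤ ℓ ≤ g − 1, set d = g + 1 − ℓ and γ = (ℓ−1)/(ℓ+1), and let i be an integer with 1 ≤ i ≤ g and i ≡ ℓ (mod 2). For an integer m with 0 ≤ m ≤ 2g+2, define σ(m) = max{0, min{d, ⌈(m − ℓ − 1)/2⌉}}. Set the partition sizes m₁ = 2g − i, m₂ = i, m₃ = 1, m₄ = 1; set w = (2g+2)/(ℓ+1), w_j = m_j/(ℓ+1), c_{j4} = σ(m_j + 1) − σ(m_j) − σ(1) for j = 1,2,3, and b = d − (σ(m₁) + σ(m₂) + σ(m₃) + σ(m₄)). Then the quantity E = (c₁₄² + c₂₄² + c₃₄²)·w/(2d) + (w₄ − (w/d)·σ(m₄))·b + Σ_{j=1}^{3} ((w/d)(σ(m_j) + σ(m₄)) − w_j − w₄)·c_{j4} − ((1+γ)/(2d))·( Σ_{j=1}^{4} σ(m_j)(d − σ(m_j))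 − Σ_{j=1}^{3} σ(m_j + 1)(d − σ(m_j + 1)) ) satisfies E = 1/(ℓ+1) if i ≥ ℓ, and E = 0 if i < ℓ. -/
theorem ceil_sub_sub_one_div_two (m n : ℕ) :
    ⌈((m : ℚ) - (n : ℚ) - 1) / 2⌉ = ((m : ℤ) - n) / 2 := by
  have h₁ : 2 * (((m : ℤ) - n) / 2) ≤ (m : ℤ) - n := by omega
  have h₂ : (m : ℤ) - n ≤ 2 * (((m : ℤ) - n) / 2) + 1 := by omega
  generalize ((m : ℤ) - n) / 2 = k at h₁ h₂ ⊢
  have h₁' : 2 * (k : ℚ) ≤ (m : ℚ) - n := by exact_mod_cast h₁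
  have h₂' : (m : ℚ) - n ≤ 2 * (k : ℚ) + 1 := by exact_mod_cast h₂
  rw [Int.ceil_eq_iff]
  constructor <;> linarith

theorem veronese_intersection_formula_evaluation
    (g ℓ i : ℕ) (hg : 2 ≤ g) (hℓ1 : 1 ≤ ℓ) (hℓg : ℓ ≤ g - 1)
    (hi1 : 1 ≤ i) (hig : i ≤ g) (hpar : i % 2 = ℓ % 2)
    (d : ℕ) (hd : d = g + 1 - ℓ)
    (γ : ℚ) (hγ : γ = ((ℓ : ℚ) - 1) / ((ℓ : ℚ) + 1))
    (σ : ℕ → ℤ)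
    (hσ : ∀ m : ℕ, σ m = max 0 (min (d : ℤ) ⌈((m : ℚ) - (ℓ : ℚ) - 1) / 2⌉))
    (m₁ m₂ m₃ m₄ : ℕ)
    (hm₁ : m₁ = 2 * g - i) (hm₂ : m₂ = i) (hm₃ : m₃ = 1) (hm₄ : m₄ = 1)
    (w : ℚ) (hw : w = (2 * (g : ℚ) + 2) / ((ℓ : ℚ) + 1))
    (w₁ w₂ w₃ w₄ : ℚ)
    (hw₁ : w₁ = (m₁ : ℚ) / ((ℓ : ℚ) + 1)) (hw₂ : w₂ = (m₂ : ℚ) / ((ℓ : ℚ) + 1))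
    (hw₃ : w₃ = (m₃ : ℚ) / ((ℓ : ℚ) + 1)) (hw₄ : w₄ = (m₄ : ℚ) / ((ℓ : ℚ) + 1))
    (c₁ c₂ c₃ : ℤ)
    (hc₁ : c₁ = σ (m₁ + 1) - σ m₁ - σ 1)
    (hc₂ : c₂ = σ (m₂ + 1) - σ m₂ - σ 1)
    (hc₃ : c₃ = σ (m₃ + 1) - σ m₃ - σ 1)
    (b : ℤ) (hb : b = (d : ℤ) - (σ m₁ + σ m₂ + σ m₃ + σ m₄))
    (E : ℚ)
    (hE : E = ((c₁ ^ 2 + c₂ ^ 2 + c₃ ^ 2 : ℤ) : ℚ) * w / (2 * (d : ℚ))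
        + (w₄ - (w / (d : ℚ)) * ((σ m₄ : ℤ) : ℚ)) * ((b : ℤ) : ℚ)
        + (((w / (d : ℚ)) * (((σ m₁ : ℤ) : ℚ) + ((σ m₄ : ℤ) : ℚ)) - w₁ - w₄) * ((c₁ : ℤ) : ℚ)
          + ((w / (d : ℚ)) * (((σ m₂ : ℤ) : ℚ) + ((σ m₄ : ℤ) : ℚ)) - w₂ - w₄) * ((c₂ : ℤ) : ℚ)
          + ((w / (d : ℚ)) * (((σ m₃ : ℤ) : ℚ) + ((σ m₄ : ℤ) : ℚ)) - w₃ - w₄) * ((c₃ : ℤ) : ℚ))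
        - ((1 + γ) / (2 * (d : ℚ))) *
          ((((σ m₁ : ℤ) : ℚ) * ((d : ℚ) - ((σ m₁ : ℤ) : ℚ))
              + ((σ m₂ : ℤ) : ℚ) * ((d : ℚ) - ((σ m₂ : ℤ) : ℚ))
              + ((σ m₃ : ℤ) : ℚ) * ((d : ℚ) - ((σ m₃ : ℤ) : ℚ))
              + ((σ m₄ : ℤ) : ℚ) * ((d : ℚ) - ((σ m₄ : ℤ) : ℚ)))
            - (((σ (m₁ + 1) : ℤ) : ℚ) * ((d : ℚ) - ((σ (m₁ + 1) : ℤ) : ℚ))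
              + ((σ (m₂ + 1) : ℤ) : ℚ) * ((d : ℚ) - ((σ (m₂ + 1) : ℤ) : ℚ))
              + ((σ (m₃ + 1) : ℤ) : ℚ) * ((d : ℚ) - ((σ (m₃ + 1) : ℤ) : ℚ))))) :
    (ℓ ≤ i → E = 1 / ((ℓ : ℚ) + 1)) ∧ (i < ℓ → E = 0) := by
  have hσ' : ∀ m : ℕ, σ m = max 0 (min (d : ℤ) (((m : ℤ) - ℓ) / 2)) := fun m => by
    rw [hσ, ceil_sub_sub_one_div_two]
  have s1 : σ 1 = 0 := by rw [hσ']; omega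
  have s2 : σ (1 + 1) = 0 := by rw [hσ']; omega
  have hstep₁ : σ (m₁ + 1) = σ m₁ := by rw [hσ', hσ']; omega
  have hstep₂ : σ (m₂ + 1) = σ m₂ := by rw [hσ', hσ']; omega
  subst hm₃ hm₄
  have hc₁' : c₁ = 0 := by omega
  have hc₂' : c₂ = 0 := by omega
  have hc₃' : c₃ = 0 := by omega
  have hEb : E = (b : ℚ) / ((ℓ : ℚ) + 1) := by
    rw [hE, hc₁', hc₂', hc₃', hstep₁, hstep₂, s1, s2, hw₄]
    push_cast
    ring
  have hσ₁ := hσ' m₁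
  have hσ₂ := hσ' m₂
  refine ⟨fun h => ?_, fun h => ?_⟩
  · have hb1 : b = 1 := by omega
    rw [hEb, hb1, Int.cast_one]
  · have hb0 : b = 0 := by omega
    rw [hEb, hb0, Int.cast_zero, zero_div]
end
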